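/- For every nonnegative integer n and every real x, the function (s,t,u,v) ↦ p_n(x; 1/s, 1/t, 1/u, 1/v), defined for s,t,u,v>0, extends to a continuous function on the closed orthant [0,∞)⁴. -/

import Mathlib

open Filter Real

/-- Pochhammer symbol `(a)_m = a (a+1) ⋯ (a+m-1)`. -/
noncomputable def poch (a : ℝ) (m : ℕ) : ℝ := ∏ j ∈ Finset.range m, (a + j)

/-- Monic Hermite polynomial of degree `n`. -/
noncomputable def monicHermite (n : ℕ) (x : ℝ) : ℝ :=
  (n.factorial : ℝ) * ∑ m ∈ Finset.range (n / 2 + 1),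
    (-1 : ℝ) ^ m * x ^ (n - 2 * m) / (4 ^ m * m.factorial * (n - 2 * m).factorial)

/-- Monic Laguerre polynomial of degree `n` with parameter `α`. -/
noncomputable def monicLaguerre (α : ℝ) (n : ℕ) (x : ℝ) : ℝ :=
  (-1 : ℝ) ^ n * n.factorial * ∑ k ∈ Finset.range (n + 1),
    (-1 : ℝ) ^ k * (poch (α + k + 1) (n - k) / ((n - k).factorial * k.factorial)) * x ^ k

/-- Monic Jacobi polynomial of degree `n` with parameters `α, β`. -/
noncomputable def monicJacobi (α β : ℝ) (n : ℕ) (x : ℝ) : ℝ :=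
  ((n.factorial : ℝ) / poch (n + α + β + 1) n) *
    ∑ k ∈ Finset.range (n + 1),
      (poch (n + α - k + 1) k / k.factorial) *
      (poch (β + k + 1) (n - k) / (n - k).factorial) *
      (x - 1) ^ (n - k) * (x + 1) ^ k

/-- Monic Racah polynomial of degree `n` in the variable `y`. -/
noncomputable def monicRacah (α β N δ : ℝ) (n : ℕ) (y : ℝ) : ℝ :=
  (1 / poch (n + α + β + 1) n) *
    ∑ k ∈ Finset.range (n + 1),
      (poch (-(n : ℝ)) k * poch (n + α + β + 1) k / k.factorial) *
      poch (α + k + 1) (n - k) * poch (β + δ + k + 1) (n - k) * poch (k - N) (n - k) *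
      ∏ j ∈ Finset.range k, ((j : ℝ) * (j + δ - N) - y)

/-- Monic Hahn polynomial of degree `n`. -/
noncomputable def monicHahn (α β N : ℝ) (n : ℕ) (x : ℝ) : ℝ :=
  (1 / poch (n + α + β + 1) n) *
    ∑ k ∈ Finset.range (n + 1),
      (poch (-(n : ℝ)) k * poch (n + α + β + 1) k * poch (-x) k / k.factorial) *
      poch (α + k + 1) (n - k) * poch (k - N) (n - k)

/-- Monic Meixner polynomial of degree `n`. -/
noncomputable def monicMeixner (b c : ℝ) (n : ℕ) (x : ℝ) : ℝ :=
  (c / (c - 1)) ^ n * ∑ k ∈ Finset.range (n + 1),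
    (poch (-(n : ℝ)) k * poch (-x) k / k.factorial) * poch (b + k) (n - k) * (1 - 1 / c) ^ k

/-- Monic Krawtchouk polynomial of degree `n`. -/
noncomputable def monicKrawtchouk (p N : ℝ) (n : ℕ) (x : ℝ) : ℝ :=
  p ^ n * ∑ k ∈ Finset.range (n + 1),
    (poch (-(n : ℝ)) k * poch (-x) k / k.factorial) * poch (k - N) (n - k) * (1 / p) ^ k

/-- `ρ = (α+β)^{3/2} / (αβ)^{1/2}`. -/
noncomputable def jacobiRho (α β : ℝ) : ℝ := (α + β) ^ ((3 : ℝ) / 2) / Real.sqrt (α * β)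

/-- `σ = (α-β)/(α+β)`. -/
noncomputable def jacobiSigma (α β : ℝ) : ℝ := (α - β) / (α + β)

/-- Uniformly rescaled monic Jacobi polynomial `p_n(x; α, β) = ρ^n p_n^{(α,β)}(ρ⁻¹x - σ)`. -/
noncomputable def rescaledJacobi (α β : ℝ) (n : ℕ) (x : ℝ) : ℝ :=
  jacobiRho α β ^ n * monicJacobi α β n (x / jacobiRho α β - jacobiSigma α β)

/-- `ρ = ((α+β)³/(αβ(β+δ)(N+α+β)(δ-α)N))^{1/2}` with `β = bα`, `δ = (bdν+1)α`, `N = bν`. -/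
noncomputable def racahRho (α b d ν : ℝ) : ℝ :=
  Real.sqrt ((α + b * α) ^ 3 /
    (α * (b * α) * (b * α + (b * d * ν + 1) * α) * (b * ν + α + b * α) *
      ((b * d * ν + 1) * α - α) * (b * ν)))

/-- `σ = -N(α+1)(β+δ+1)/(α+β+2)` with `β = bα`, `δ = (bdν+1)α`, `N = bν`. -/
noncomputable def racahSigma (α b d ν : ℝ) : ℝ :=
  -((b * ν) * (α + 1) * (b * α + (b * d * ν + 1) * α + 1)) / (α + b * α + 2)

/-- Rescaled monic Racah polynomial `p_n(x; α, b, d, ν) = ρ^n r_n(ρ⁻¹x - σ; α, bα, bν, (bdν+1)α)`. -/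
noncomputable def rescaledRacah (α b d ν : ℝ) (n : ℕ) (x : ℝ) : ℝ :=
  racahRho α b d ν ^ n *
    monicRacah α (b * α) (b * ν) ((b * d * ν + 1) * α) n
      (x / racahRho α b d ν - racahSigma α b d ν)
theorem poch_zero (a : ℝ) : poch a 0 = 1 := by simp [poch]

theorem poch_succ (a : ℝ) (m : ℕ) : poch a (m + 1) = poch a m * (a + m) := by
  simp [poch, Finset.prod_range_succ]

theorem poch_succ_left (a : ℝ) (m : ℕ) : poch a (m + 1) = a * poch (a + 1) m := by
  simp only [poch, Finset.prod_range_succ']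
  rw [mul_comm]
  congr 1
  · simp
  · refine Finset.prod_congr rfl fun j _ => ?_
    push_cast
    ring

theorem poch_add (a : ℝ) (m k : ℕ) : poch a (m + k) = poch a m * poch (a + m) k := by
  simp only [poch, Finset.prod_range_add]
  congr 1
  refine Finset.prod_congr rfl fun j _ => ?_
  push_cast
  ring

theorem poch_pos {a : ℝ} (ha : 0 < a) (m : ℕ) : 0 < poch a m :=
  Finset.prod_pos fun j _ => by positivity

theorem poch_neg_natCast_div_factorial (n k : ℕ) :
    poch (-(n : ℝ)) k / k.factorial = (-1) ^ k * n.choose k := by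
  rw [div_eq_iff (by positivity)]
  induction k with
  | zero => simp [poch_zero]
  | succ k ih =>
    have h : (n.choose (k + 1) : ℝ) * (k + 1) = n.choose k * (n - k) := by
      rcases le_or_gt k n with hk | hk
      · have := Nat.choose_succ_right_eq n k
        rw [← Nat.cast_sub hk]
        exact_mod_cast this
      · simp [Nat.choose_eq_zero_of_lt hk, Nat.choose_eq_zero_of_lt (Nat.lt_succ_of_lt hk)]
    rw [poch_succ, ih, Nat.factorial_succ]
    push_cast
    linear_combination (-1 : ℝ) ^ k * k.factorial * h

/-- Coefficient of the monic Racah polynomial of degree `n` in the Newton-type basis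
`racahBasis`. -/
noncomputable def racahCoeff (α β N δ : ℝ) (n k : ℕ) : ℝ :=
  (-1) ^ k * n.choose k *
    (poch (α + k + 1) (n - k) * poch (β + δ + k + 1) (n - k) * poch (k - N) (n - k)) *
    poch (α + β + 1) (n + k) / poch (α + β + 1) (2 * n)

/-- The products `∏_{j<k} (j(j+δ-N) - y)`. -/
noncomputable def racahBasis (N δ y : ℝ) (k : ℕ) : ℝ :=
  ∏ j ∈ Finset.range k, ((j : ℝ) * (j + δ - N) - y)

/-- The cubic whose rising products are the numerators of `racahCoeff`. -/
def racahCubic (α β N δ z : ℝ) : ℝ := (α + 1 + z) * (β + δ + 1 + z) * (z - N)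

/-- The coefficient `A_n` of the Racah recurrence relation. -/
noncomputable def racahA (α β N δ n : ℝ) : ℝ :=
  (n + α + 1) * (n + α + β + 1) * (n + β + δ + 1) * (n - N) /
    ((2 * n + α + β + 1) * (2 * n + α + β + 2))

/-- The coefficient `C_n` of the Racah recurrence relation. -/
noncomputable def racahC (α β N δ n : ℝ) : ℝ :=
  n * (n + α + β + N + 1) * (n + α - δ) * (n + β) /
    ((2 * n + α + β) * (2 * n + α + β + 1))

theorem racahCoeff_eq_zero (α β N δ : ℝ) {n k : ℕ} (h : n < k) :
    racahCoeff α β N δ n k = 0 := by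
  simp [racahCoeff, Nat.choose_eq_zero_of_lt h]

theorem monicRacah_eq_sum {α β : ℝ} (h : 0 < α + β) (N δ : ℝ) {n M : ℕ} (hM : n + 1 ≤ M) (y : ℝ) :
    monicRacah α β N δ n y =
      ∑ k ∈ Finset.range M, racahCoeff α β N δ n k * racahBasis N δ y k := by
  have hsub : Finset.range (n + 1) ⊆ Finset.range M := Finset.range_subset_range.2 hM
  rw [← Finset.sum_subset hsub fun k _ hk => by
    rw [racahCoeff_eq_zero _ _ _ _ (by simpa using hk), zero_mul]]
  rw [monicRacah, Finset.mul_sum]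
  refine Finset.sum_congr rfl fun k _ => ?_
  have h1 : poch (α + β + 1) (2 * n) = poch (α + β + 1) n * poch (n + α + β + 1) n := by
    rw [two_mul, poch_add]
    ring_nf
  have h2 : poch (α + β + 1) (n + k) = poch (α + β + 1) n * poch (n + α + β + 1) k := by
    rw [poch_add]
    ring_nf
  have h3 : poch (α + β + 1) n ≠ 0 := (poch_pos (by linarith) n).ne'
  have h4 : poch (n + α + β + 1) n ≠ 0 :=
    (poch_pos (by linarith [(Nat.cast_nonneg n : (0 : ℝ) ≤ n)]) n).ne'
  rw [racahCoeff, racahBasis, h1, h2, ← poch_neg_natCast_div_factorial]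
  field_simp

theorem racahCoeff_succ_left {α β : ℝ} (h : 0 < α + β) (N δ : ℝ) {n k : ℕ} (hk : k ≤ n) :
    racahCoeff α β N δ (n + 1) k * (n + 1 - k) *
        ((2 * n + α + β + 1) * (2 * n + α + β + 2)) =
      (n + 1) * racahCubic α β N δ n * (n + k + α + β + 1) * racahCoeff α β N δ n k := by
  have hc : (n.choose k : ℝ) * (n + 1) = (n + 1).choose k * (n + 1 - k) := by
    have := Nat.choose_mul_succ_eq n k
    rw [← Nat.cast_succ, ← Nat.cast_sub (by omega)]
    exact_mod_cast this
  have hG : poch (α + β + 1) (2 * n) ≠ 0 := (poch_pos (by linarith) _).ne'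
  have p1 : α + β + 1 + ((2 * n : ℕ) : ℝ) ≠ 0 := by positivity
  have p2 : α + β + 1 + ((2 * n + 1 : ℕ) : ℝ) ≠ 0 := by positivity
  have e2 : n + 1 - k = (n - k) + 1 := by omega
  have e3 : n + 1 + k = (n + k) + 1 := by omega
  have e4 : 2 * (n + 1) = 2 * n + 1 + 1 := by omega
  rw [racahCoeff, racahCoeff, racahCubic, e2, e3, e4]
  simp only [poch_succ]
  rw [Nat.cast_sub hk]
  generalize poch (α + β + 1) (2 * n) = G at hG
  push_cast at p1 p2 ⊢
  rw [show 2 * (n : ℝ) + α + β + 1 = α + β + 1 + 2 * n by ring,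
    show 2 * (n : ℝ) + α + β + 2 = α + β + 1 + (2 * n + 1) by ring]
  generalize α + β + 1 + 2 * (n : ℝ) = d at p1
  generalize α + β + 1 + (2 * (n : ℝ) + 1) = d' at p2
  rw [div_mul_eq_mul_div, div_mul_eq_mul_div, mul_div_assoc',
    div_eq_div_iff (mul_ne_zero (mul_ne_zero hG p1) p2) hG]
  linear_combination (-1) * (-1) ^ k * (poch (α + k + 1) (n - k)) * poch (β + δ + k + 1) (n - k) *
    poch (k - N) (n - k) * poch (α + β + 1) (n + k) *
    (α + 1 + n) * (β + δ + 1 + n) * (n - N) * (α + β + 1 + (n + k)) * (G * d * d') * hc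

theorem racahCoeff_succ_right (α β N δ : ℝ) {n k : ℕ} (hk : k < n) :
    racahCoeff α β N δ n k * (n - k) * (n + k + α + β + 1) =
      -((k + 1) * racahCubic α β N δ k * racahCoeff α β N δ n (k + 1)) := by
  have hc : (n.choose (k + 1) : ℝ) * (k + 1) = n.choose k * (n - k) := by
    rw [← Nat.cast_sub hk.le]
    exact_mod_cast Nat.choose_succ_right_eq n k
  have e2 : n - k = (n - (k + 1)) + 1 := by omega
  have e3 : n + (k + 1) = (n + k) + 1 := by omega
  rw [racahCoeff, racahCoeff, racahCubic, e2, e3]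
  simp only [poch_succ_left (_ + _) (n - (k + 1)), poch_succ_left (_ - _) (n - (k + 1)),
    poch_succ _ (n + k)]
  have a1 : α + ((k + 1 : ℕ) : ℝ) + 1 = α + k + 1 + 1 := by push_cast; ring
  have a2 : β + δ + ((k + 1 : ℕ) : ℝ) + 1 = β + δ + k + 1 + 1 := by push_cast; ring
  have a3 : ((k + 1 : ℕ) : ℝ) - N = k - N + 1 := by push_cast; ring
  rw [a1, a2, a3]
  push_cast
  linear_combination (-1) * (-1) ^ k * poch (α + k + 1 + 1) (n - (k + 1)) *
    poch (β + δ + k + 1 + 1) (n - (k + 1)) *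
    poch (k - N + 1) (n - (k + 1)) * poch (α + β + 1) (n + k) / poch (α + β + 1) (2 * n) *
    (α + 1 + k) * (β + δ + 1 + k) * (k - N) * (α + β + 1 + (n + k)) * hc

theorem racahCoeff_self {α β : ℝ} (h : 0 < α + β) (N δ : ℝ) (n : ℕ) :
    racahCoeff α β N δ n n = (-1) ^ n := by
  have hG : poch (α + β + 1) (n + n) ≠ 0 := (poch_pos (by linarith) _).ne'
  simp [racahCoeff, poch_zero, two_mul, hG]

theorem racahA_mul_racahCoeff {α β : ℝ} (h : 0 < α + β) (N δ : ℝ) {n k : ℕ} (hk : k ≤ n + 1) :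
    racahA α β N δ n * racahCoeff α β N δ n k * ((n + 1) * (n + k + α + β + 1)) =
      (n + 1 - k) * (n + α + β + 1) * racahCoeff α β N δ (n + 1) k := by
  rcases hk.eq_or_lt with rfl | hk
  · rw [racahCoeff_eq_zero _ _ _ _ (Nat.lt_succ_self n)]
    push_cast
    ring
  · have := racahCoeff_succ_left h N δ (Nat.le_of_lt_succ hk)
    have p1 : 2 * (n : ℝ) + α + β + 1 ≠ 0 := by
      have : (0 : ℝ) ≤ n := n.cast_nonneg
      linarith
    have p2 : 2 * (n : ℝ) + α + β + 2 ≠ 0 := by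
      have : (0 : ℝ) ≤ n := n.cast_nonneg
      linarith
    have p : (2 * (n : ℝ) + α + β + 1) * (2 * n + α + β + 2) ≠ 0 := mul_ne_zero p1 p2
    rw [racahCubic] at this
    rw [racahA, div_mul_eq_mul_div, div_mul_eq_mul_div, div_eq_iff p]
    linear_combination (-(n + α + β + 1)) * this

theorem racah_rational_identity (α β N δ m k : ℝ) (h1 : m + 1 - k ≠ 0)
    (h2 : m + k + α + β ≠ 0) (h3 : 2 * m + α + β ≠ 0) (h4 : 2 * m + α + β + 1 ≠ 0)
    (h5 : 2 * m + α + β + 2 ≠ 0) :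
    (m + 1) * racahCubic α β N δ m * (m + k + α + β + 1) /
        ((m + 1 - k) * ((2 * m + α + β + 1) * (2 * m + α + β + 2))) =
      k * (k + δ - N) + racahA α β N δ m + racahC α β N δ m +
        k * racahCubic α β N δ (k - 1) / ((m + 1 - k) * (m + k + α + β)) -
        (m + α + β + N + 1) * (m + α - δ) * (m + β) /
          ((2 * m + α + β) * (2 * m + α + β + 1)) * (m - k) * (m + α + β) / (m + k + α + β) := by
  simp only [racahCubic, racahA, racahC]
  obtain ⟨d1, e1⟩ : ∃ d, d = m + 1 - k := ⟨_, rfl⟩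
  obtain ⟨d2, e2⟩ : ∃ d, d = m + k + α + β := ⟨_, rfl⟩
  obtain ⟨d3, e3⟩ : ∃ d, d = 2 * m + α + β := ⟨_, rfl⟩
  obtain ⟨d4, e4⟩ : ∃ d, d = 2 * m + α + β + 1 := ⟨_, rfl⟩
  obtain ⟨d5, e5⟩ : ∃ d, d = 2 * m + α + β + 2 := ⟨_, rfl⟩
  rw [← e1] at h1
  rw [← e2] at h2
  rw [← e3] at h3
  rw [← e4] at h4
  rw [← e5] at h5
  rw [← e1, ← e5, ← e4, ← e3, ← e2]
  field_simp
  subst e1 e2 e3 e4 e5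
  ring

theorem racahCoeff_recurrence {α β : ℝ} (h : 0 < α + β) (N δ : ℝ) {n k : ℕ} (hk : k ≤ n + 1)
    {c : ℝ} (hc : c * (n + 2 - k) * (n + 1 + k + α + β) =
      -(k * racahCubic α β N δ (k - 1) * racahCoeff α β N δ (n + 1) k)) :
    racahCoeff α β N δ (n + 2) k =
      (k * (k + δ - N) + racahA α β N δ (n + 1) + racahC α β N δ (n + 1)) *
        racahCoeff α β N δ (n + 1) k - c -
      racahA α β N δ n * racahC α β N δ (n + 1) * racahCoeff α β N δ n k := by
  have hn : (0 : ℝ) ≤ n := n.cast_nonneg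
  have hk0 : (0 : ℝ) ≤ k := k.cast_nonneg
  have hk' : (k : ℝ) ≤ n + 1 := by exact_mod_cast hk
  have r1 := racahCoeff_succ_left h N δ hk
  have r2 := racahA_mul_racahCoeff h N δ hk
  push_cast at r1
  have c1 : (n : ℝ) + 2 - k = n + 1 + 1 - k := by ring
  have c2 : (n : ℝ) + k + α + β + 1 = n + 1 + k + α + β := by ring
  have c3 : (n : ℝ) + α + β + 1 = n + 1 + α + β := by ring
  rw [c1] at hc
  rw [c2, c3] at r2
  set x := racahCoeff α β N δ (n + 1) k
  rw [show n + 2 = n + 1 + 1 from rfl]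
  set z := racahCoeff α β N δ (n + 1 + 1) k
  rw [mul_right_comm]
  set w := racahA α β N δ n * racahCoeff α β N δ n k
  clear_value x z w
  have hm : (1 : ℝ) ≤ n + 1 := by linarith
  generalize (n : ℝ) + 1 = m at *
  have q1 : m + 1 - k ≠ 0 := by linarith
  have q2 : m + k + α + β ≠ 0 := by linarith
  have q3 : 2 * m + α + β ≠ 0 := by linarith
  have q4 : 2 * m + α + β + 1 ≠ 0 := by linarith
  have q5 : 2 * m + α + β + 2 ≠ 0 := by linarith
  have q6 : m ≠ 0 := by linarith
  have s1 : z = (m + 1) * racahCubic α β N δ m * (m + k + α + β + 1) /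
      ((m + 1 - k) * ((2 * m + α + β + 1) * (2 * m + α + β + 2))) * x := by
    rw [div_mul_eq_mul_div, eq_div_iff (mul_ne_zero q1 (mul_ne_zero q4 q5))]
    linear_combination r1
  have s2 : w = (m - k) * (m + α + β) / (m * (m + k + α + β)) * x := by
    rw [div_mul_eq_mul_div, eq_div_iff (mul_ne_zero q6 q2)]
    linear_combination r2
  have s3 : c = -(k * racahCubic α β N δ (k - 1) / ((m + 1 - k) * (m + k + α + β))) * x := by
    rw [← neg_div, div_mul_eq_mul_div, eq_div_iff (mul_ne_zero q1 q2)]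
    linear_combination hc
  have hC : racahC α β N δ m = m * ((m + α + β + N + 1) * (m + α - δ) * (m + β) /
      ((2 * m + α + β) * (2 * m + α + β + 1))) := by
    rw [racahC]
    ring
  have hCw : w * racahC α β N δ m = (m + α + β + N + 1) * (m + α - δ) * (m + β) /
      ((2 * m + α + β) * (2 * m + α + β + 1)) * (m - k) * (m + α + β) / (m + k + α + β) * x := by
    rw [hC, s2]
    generalize (m + α + β + N + 1) * (m + α - δ) * (m + β) /
      ((2 * m + α + β) * (2 * m + α + β + 1)) = X
    generalize m + k + α + β = q at q2
    field_simp
  rw [s1, hCw, s3, racah_rational_identity α β N δ m k q1 q2 q3 q4 q5]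
  ring

theorem monicRacah_recurrence {α β : ℝ} (h : 0 < α + β) (N δ : ℝ) (n : ℕ) (y : ℝ) :
    monicRacah α β N δ (n + 2) y =
      (y + racahA α β N δ (n + 1) + racahC α β N δ (n + 1)) * monicRacah α β N δ (n + 1) y -
      racahA α β N δ n * racahC α β N δ (n + 1) * monicRacah α β N δ n y := by
  have hshift : ∑ k ∈ Finset.range (n + 3), racahCoeff α β N δ (n + 1) k * racahBasis N δ y (k + 1) =
      ∑ k ∈ Finset.range (n + 3),
        (if k = 0 then 0 else racahCoeff α β N δ (n + 1) (k - 1)) * racahBasis N δ y k := by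
    rw [Finset.sum_range_succ, racahCoeff_eq_zero α β N δ (show n + 1 < n + 2 by omega),
      Finset.sum_range_succ' _ (n + 2)]
    simp
  have hy : y * monicRacah α β N δ (n + 1) y =
      ∑ k ∈ Finset.range (n + 3), (k * (k + δ - N) * racahCoeff α β N δ (n + 1) k -
        if k = 0 then 0 else racahCoeff α β N δ (n + 1) (k - 1)) * racahBasis N δ y k := by
    simp only [sub_mul, Finset.sum_sub_distrib]
    rw [← hshift, ← Finset.sum_sub_distrib,
      monicRacah_eq_sum h N δ (show n + 1 + 1 ≤ n + 3 by omega), Finset.mul_sum]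
    refine Finset.sum_congr rfl fun k _ => ?_
    rw [racahBasis, racahBasis, Finset.prod_range_succ]
    ring
  rw [add_assoc, add_mul, hy, monicRacah_eq_sum h N δ (show n + 2 + 1 ≤ n + 3 by omega),
    monicRacah_eq_sum h N δ (show n + 1 + 1 ≤ n + 3 by omega),
    monicRacah_eq_sum h N δ (show n + 1 ≤ n + 3 by omega), Finset.mul_sum, Finset.mul_sum,
    ← Finset.sum_add_distrib, ← Finset.sum_sub_distrib]
  refine Finset.sum_congr rfl fun k hk => ?_
  have hk : k < n + 3 := Finset.mem_range.1 hk
  rcases Nat.lt_or_ge k (n + 2) with hk1 | hk1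
  · rw [racahCoeff_recurrence h N δ (show k ≤ n + 1 by omega)
      (c := if k = 0 then 0 else racahCoeff α β N δ (n + 1) (k - 1))]
    · ring
    · rcases k with _ | k
      · simp
      · have := racahCoeff_succ_right α β N δ (n := n + 1) (k := k) (by omega)
        simp only [Nat.add_eq_zero_iff, one_ne_zero, and_false, if_false, Nat.add_sub_cancel]
        push_cast at this ⊢
        rw [add_sub_cancel_right]
        linear_combination this
  · obtain rfl : k = n + 2 := by omega
    rw [racahCoeff_self h, racahCoeff_eq_zero α β N δ (show n + 1 < n + 2 by omega),
      racahCoeff_eq_zero α β N δ (show n < n + 2 by omega), if_neg (by omega),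
      show n + 2 - 1 = n + 1 by omega, racahCoeff_self h]
    ring

theorem monicRacah_zero (α β N δ y : ℝ) : monicRacah α β N δ 0 y = 1 := by
  simp [monicRacah, poch_zero]

theorem monicRacah_one {α β : ℝ} (h : 0 < α + β) (N δ y : ℝ) :
    monicRacah α β N δ 1 y = y + racahA α β N δ 0 := by
  have h1 : 1 + α + β + 1 ≠ 0 := by linarith
  have h2 : α + β + 1 ≠ 0 := by linarith
  have h3 : α + β + 2 ≠ 0 := by linarith
  simp [monicRacah, poch, Finset.sum_range_succ, racahA]
  field_simp
  ring

theorem monicRacah_rescaled_recurrence {α β : ℝ} (h : 0 < α + β) (N δ : ℝ) {ρ : ℝ} (hρ : ρ ≠ 0)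
    (σ x : ℝ) (n : ℕ) :
    ρ ^ (n + 2) * monicRacah α β N δ (n + 2) (x / ρ - σ) =
      (x + ρ * (racahA α β N δ (n + 1) + racahC α β N δ (n + 1) - σ)) *
          (ρ ^ (n + 1) * monicRacah α β N δ (n + 1) (x / ρ - σ)) -
        ρ ^ 2 * (racahA α β N δ n * racahC α β N δ (n + 1)) *
          (ρ ^ n * monicRacah α β N δ n (x / ρ - σ)) := by
  rw [monicRacah_recurrence h]
  have hx : ρ * (x / ρ) = x := mul_div_cancel₀ x hρ
  linear_combination ρ ^ (n + 1) * monicRacah α β N δ (n + 1) (x / ρ - σ) * hx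

/-- A quotient `f / √g` with `0 ≤ f ≤ g` is continuous even where `g` vanishes. -/
theorem ContinuousOn.div_sqrt_of_le {X : Type*} [TopologicalSpace X] {S : Set X} {f g : X → ℝ}
    (hf : ContinuousOn f S) (hg : ContinuousOn g S) (h0 : ∀ p ∈ S, 0 ≤ f p)
    (hle : ∀ p ∈ S, f p ≤ g p) : ContinuousOn (fun p => f p / √(g p)) S := by
  intro p hp
  rcases eq_or_ne (g p) 0 with h | h
  · have hfp : f p = 0 := le_antisymm (h ▸ hle p hp) (h0 p hp)
    have hs : ContinuousWithinAt (fun p => √(f p)) S p := (hf p hp).sqrt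
    rw [ContinuousWithinAt, hfp, Real.sqrt_zero] at hs
    rw [ContinuousWithinAt, hfp, zero_div]
    refine tendsto_of_tendsto_of_tendsto_of_le_of_le' tendsto_const_nhds hs ?_ ?_
    · filter_upwards [self_mem_nhdsWithin] with q hq
      exact div_nonneg (h0 q hq) (Real.sqrt_nonneg _)
    · filter_upwards [self_mem_nhdsWithin] with q hq
      refine div_le_of_le_mul₀ (Real.sqrt_nonneg _) (Real.sqrt_nonneg _) ?_
      calc f q = √(f q) * √(f q) := (Real.mul_self_sqrt (h0 q hq)).symm
        _ ≤ √(f q) * √(g q) := by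
          gcongr
          exact hle q hq
  · have hgp : 0 < g p := lt_of_le_of_ne ((h0 p hp).trans (hle p hp)) h.symm
    exact (hf p hp).div (hg p hp).sqrt (Real.sqrt_pos.2 hgp).ne'

/-- The closed orthant `[0,∞)⁴`. -/
def orthant : Set (ℝ × ℝ × ℝ × ℝ) :=
  Set.Ici 0 ×ˢ (Set.Ici 0 ×ˢ (Set.Ici 0 ×ˢ Set.Ici 0))

/-- `st(k + α + β)` in the inverse parameters. -/
def denomD (k s t : ℝ) : ℝ := k * (s * t) + (1 + t)

/-- `stuv(β + δ)` in the inverse parameters. -/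
def denomM (t u v : ℝ) : ℝ := 1 + u * v + t * u * v

/-- `stv(N + α + β)` in the inverse parameters. -/
def denomW (s t v : ℝ) : ℝ := s + v + t * v

/-- The factor of `racahRho` that is regular on the closed orthant. -/
noncomputable def rhoFactor (t u v : ℝ) : ℝ := √((1 + t) ^ 3 / denomM t u v)

/-- `stuv² A_m` in the inverse parameters. -/
noncomputable def scaledA (m s t u v : ℝ) : ℝ :=
  ((m + 1) * s + 1) * denomD (m + 1) s t * (denomM t u v + (m + 1) * (s * t * u * v)) *
    (m * (t * v) - 1) * (denomD (2 * m + 1) s t)⁻¹ * (denomD (2 * m + 2) s t)⁻¹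

/-- `stuv² C_m` in the inverse parameters. -/
noncomputable def scaledC (m s t u v : ℝ) : ℝ :=
  m * ((m + 1) * (s * t * v) + denomW s t v) * (m * (s * t * u * v) - 1) * (m * (s * t) + 1) *
    (denomD (2 * m) s t)⁻¹ * (denomD (2 * m + 1) s t)⁻¹

/-- Coefficient of `s` in `stuv² (A_m + C_m - A_0)`. -/
noncomputable def shiftS (m s t u v : ℝ) : ℝ :=
  (1 + t * u * v) * (2 * m * (t - 1)) * denomD (m + 1) s t *
    (denomD (2 * m) s t)⁻¹ * (denomD (2 * m + 2) s t)⁻¹ * (denomD 2 s t)⁻¹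

/-- Coefficient of `v` in `stuv² (A_m + C_m - A_0)`. -/
noncomputable def shiftV (m s t u v : ℝ) : ℝ :=
  (1 + t * u * v) * (m * (t - 1)) * denomD (m + 1) s t *
      (denomD (2 * m) s t)⁻¹ * (denomD (2 * m + 2) s t)⁻¹ +
    (m * (t * u * v) - u) * (((m + 1) * s + 1) * ((m + 1) * (s * t) + 1) * denomD (m + 1) s t *
      (denomD (2 * m + 1) s t)⁻¹ * (denomD (2 * m + 2) s t)⁻¹) +
    m * (m * (s * t) + 1) * (m * s + 1) * (s * t * u + t * u * v * denomD (m + 1) s t) *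
      (denomD (2 * m) s t)⁻¹ * (denomD (2 * m + 1) s t)⁻¹ +
    u * (s + 1) * (s * t + 1) * (denomD 2 s t)⁻¹

theorem scaledA_add_scaledC_sub {m s t u v : ℝ} (h1 : denomD 1 s t ≠ 0) (h2 : denomD 2 s t ≠ 0)
    (h3 : denomD (2 * m) s t ≠ 0) (h4 : denomD (2 * m + 1) s t ≠ 0)
    (h5 : denomD (2 * m + 2) s t ≠ 0) :
    scaledA m s t u v + scaledC m s t u v - scaledA 0 s t u v =
      s * shiftS m s t u v + v * shiftV m s t u v := by
  simp only [scaledA, scaledC, shiftS, shiftV, zero_add, mul_zero]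
  obtain ⟨d1, e1⟩ : ∃ d, d = denomD 1 s t := ⟨_, rfl⟩
  obtain ⟨d2, e2⟩ : ∃ d, d = denomD 2 s t := ⟨_, rfl⟩
  obtain ⟨d3, e3⟩ : ∃ d, d = denomD (2 * m) s t := ⟨_, rfl⟩
  obtain ⟨d4, e4⟩ : ∃ d, d = denomD (2 * m + 1) s t := ⟨_, rfl⟩
  obtain ⟨d5, e5⟩ : ∃ d, d = denomD (2 * m + 2) s t := ⟨_, rfl⟩
  simp only [← e1, ← e2, ← e3, ← e4, ← e5] at h1 h2 h3 h4 h5 ⊢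
  field_simp
  subst e1 e2 e3 e4 e5
  simp only [denomD, denomM, denomW]
  ring

/-- The continuous extension of `ρ (A_m + C_m - σ)`. -/
noncomputable def limitB (m s t u v : ℝ) : ℝ :=
  rhoFactor t u v * (s / √(denomW s t v) * shiftS m s t u v +
    v / √(denomW s t v) * shiftV m s t u v)

/-- The continuous extension of `ρ² A_m C_{m+1}`. -/
noncomputable def limitG (m s t u v : ℝ) : ℝ :=
  (1 + t) ^ 3 * (denomM t u v)⁻¹ * scaledA m s t u v *
    ((m + 1) * (1 + (m + 2) * t * (s / √(denomW s t v)) * (v / √(denomW s t v))) *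
      ((m + 1) * (s * t * u * v) - 1) * ((m + 1) * (s * t) + 1) *
      (denomD (2 * m + 2) s t)⁻¹ * (denomD (2 * m + 3) s t)⁻¹)

theorem denomD_pos {k s t : ℝ} (hk : 0 ≤ k) (hs : 0 ≤ s) (ht : 0 ≤ t) : 0 < denomD k s t := by
  unfold denomD
  positivity

theorem denomM_pos {t u v : ℝ} (ht : 0 ≤ t) (hu : 0 ≤ u) (hv : 0 ≤ v) : 0 < denomM t u v := by
  unfold denomM
  positivity

theorem continuousOn_inv_denomD {k : ℝ} (hk : 0 ≤ k) :
    ContinuousOn (fun p : ℝ × ℝ × ℝ × ℝ => (denomD k p.1 p.2.1)⁻¹) orthant := by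
  refine ContinuousOn.inv₀ ?_ fun p hp => (denomD_pos hk hp.1 hp.2.1).ne'
  unfold denomD
  fun_prop

theorem continuousOn_inv_denomM :
    ContinuousOn (fun p : ℝ × ℝ × ℝ × ℝ => (denomM p.2.1 p.2.2.1 p.2.2.2)⁻¹) orthant := by
  refine ContinuousOn.inv₀ ?_ fun p hp => (denomM_pos hp.2.1 hp.2.2.1 hp.2.2.2).ne'
  unfold denomM
  fun_prop

theorem continuous_denomD (k : ℝ) :
    Continuous (fun p : ℝ × ℝ × ℝ × ℝ => denomD k p.1 p.2.1) := by
  unfold denomD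
  fun_prop

theorem continuousOn_div_sqrt_denomW_left :
    ContinuousOn (fun p : ℝ × ℝ × ℝ × ℝ => p.1 / √(denomW p.1 p.2.1 p.2.2.2)) orthant := by
  refine ContinuousOn.div_sqrt_of_le (by fun_prop) (by unfold denomW; fun_prop)
    (fun p hp => hp.1) ?_
  rintro ⟨s, t, u, v⟩ ⟨hs, ht, hu, hv⟩
  simp only [Set.mem_Ici] at hs ht hu hv
  simp only [denomW]
  nlinarith [mul_nonneg ht hv]

theorem continuousOn_div_sqrt_denomW_right :
    ContinuousOn (fun p : ℝ × ℝ × ℝ × ℝ => p.2.2.2 / √(denomW p.1 p.2.1 p.2.2.2)) orthant := by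
  refine ContinuousOn.div_sqrt_of_le (by fun_prop) (by unfold denomW; fun_prop)
    (fun p hp => hp.2.2.2) ?_
  rintro ⟨s, t, u, v⟩ ⟨hs, ht, hu, hv⟩
  simp only [Set.mem_Ici] at hs ht hu hv
  simp only [denomW]
  nlinarith [mul_nonneg ht hv]

theorem continuousOn_rhoFactor :
    ContinuousOn (fun p : ℝ × ℝ × ℝ × ℝ => rhoFactor p.2.1 p.2.2.1 p.2.2.2) orthant := by
  have h := continuousOn_inv_denomM
  simp only [rhoFactor, div_eq_mul_inv]
  fun_prop

theorem continuousOn_limitB {m : ℝ} (hm : 0 ≤ m) :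
    ContinuousOn (fun p : ℝ × ℝ × ℝ × ℝ => limitB m p.1 p.2.1 p.2.2.1 p.2.2.2) orthant := by
  have h1 := continuousOn_rhoFactor
  have h2 := continuousOn_div_sqrt_denomW_left
  have h3 := continuousOn_div_sqrt_denomW_right
  have h4 := (continuous_denomD (m + 1)).continuousOn (s := orthant)
  have h5 := continuousOn_inv_denomD (k := 2 * m) (by positivity)
  have h6 := continuousOn_inv_denomD (k := 2 * m + 1) (by positivity)
  have h7 := continuousOn_inv_denomD (k := 2 * m + 2) (by positivity)
  have h8 := continuousOn_inv_denomD (k := 2) (by positivity)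
  simp only [limitB, shiftS, shiftV]
  fun_prop

theorem continuousOn_limitG {m : ℝ} (hm : 0 ≤ m) :
    ContinuousOn (fun p : ℝ × ℝ × ℝ × ℝ => limitG m p.1 p.2.1 p.2.2.1 p.2.2.2) orthant := by
  have h1 := continuousOn_inv_denomM
  have h2 := continuousOn_div_sqrt_denomW_left
  have h3 := continuousOn_div_sqrt_denomW_right
  have h4 := (continuous_denomD (m + 1)).continuousOn (s := orthant)
  have h5 := continuousOn_inv_denomD (k := 2 * m + 1) (by positivity)
  have h6 := continuousOn_inv_denomD (k := 2 * m + 2) (by positivity)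
  have h7 := continuousOn_inv_denomD (k := 2 * m + 3) (by positivity)
  have h8 : ContinuousOn (fun p : ℝ × ℝ × ℝ × ℝ => denomM p.2.1 p.2.2.1 p.2.2.2) orthant := by
    unfold denomM
    fun_prop
  simp only [limitG, scaledA]
  fun_prop

theorem racahA_inverse_parameters {m s t u v : ℝ} (hm : 0 ≤ m) (hs : 0 < s) (ht : 0 < t)
    (hu : 0 < u) (hv : 0 < v) :
    racahA (1 / s) (1 / t * (1 / s)) (1 / t * (1 / v)) ((1 / t * (1 / u) * (1 / v) + 1) * (1 / s)) m =
      scaledA m s t u v / (s * t * u * v ^ 2) := by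
  have h1 := (denomD_pos (k := 2 * m + 1) (by positivity) hs.le ht.le).ne'
  have h2 := (denomD_pos (k := 2 * m + 2) (by positivity) hs.le ht.le).ne'
  have e1 : 2 * m + 1 / s + 1 / t * (1 / s) + 1 = denomD (2 * m + 1) s t / (s * t) := by
    rw [denomD]
    field_simp
    ring
  have e2 : 2 * m + 1 / s + 1 / t * (1 / s) + 2 = denomD (2 * m + 2) s t / (s * t) := by
    rw [denomD]
    field_simp
    ring
  have e3 : m + 1 / s + 1 / t * (1 / s) + 1 = denomD (m + 1) s t / (s * t) := by
    rw [denomD]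
    field_simp
    ring
  have e4 : m + 1 / t * (1 / s) + (1 / t * (1 / u) * (1 / v) + 1) * (1 / s) + 1 =
      (denomM t u v + (m + 1) * (s * t * u * v)) / (s * t * u * v) := by
    rw [denomM]
    field_simp
    ring
  rw [racahA, e1, e2, e3, e4, scaledA]
  generalize denomD (2 * m + 1) s t = d1 at h1
  generalize denomD (2 * m + 2) s t = d2 at h2
  field_simp
  ring

theorem racahC_inverse_parameters {m s t u v : ℝ} (hm : 0 ≤ m) (hs : 0 < s) (ht : 0 < t)
    (hu : 0 < u) (hv : 0 < v) :
    racahC (1 / s) (1 / t * (1 / s)) (1 / t * (1 / v)) ((1 / t * (1 / u) * (1 / v) + 1) * (1 / s)) m =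
      scaledC m s t u v / (s * t * u * v ^ 2) := by
  have h1 := (denomD_pos (k := 2 * m + 1) (by positivity) hs.le ht.le).ne'
  have h2 := (denomD_pos (k := 2 * m) (by positivity) hs.le ht.le).ne'
  have e1 : 2 * m + 1 / s + 1 / t * (1 / s) + 1 = denomD (2 * m + 1) s t / (s * t) := by
    rw [denomD]
    field_simp
    ring
  have e2 : 2 * m + 1 / s + 1 / t * (1 / s) = denomD (2 * m) s t / (s * t) := by
    rw [denomD]
    field_simp
    ring
  have e3 : m + 1 / s + 1 / t * (1 / s) + 1 / t * (1 / v) + 1 =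
      ((m + 1) * (s * t * v) + denomW s t v) / (s * t * v) := by
    rw [denomW]
    field_simp
    ring
  have e4 : m + 1 / s - (1 / t * (1 / u) * (1 / v) + 1) * (1 / s) =
      (m * (s * t * u * v) - 1) / (s * t * u * v) := by
    field_simp
    ring
  rw [racahC, e1, e2, e3, e4, scaledC]
  generalize denomD (2 * m + 1) s t = d1 at h1
  generalize denomD (2 * m) s t = d2 at h2
  field_simp

theorem racahRho_inverse_parameters {s t u v : ℝ} (hs : 0 < s) (ht : 0 < t)
    (hu : 0 < u) (hv : 0 < v) :
    racahRho (1 / s) (1 / t) (1 / u) (1 / v) =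
      s * t * u * v ^ 2 * rhoFactor t u v / √(denomW s t v) := by
  have hM := denomM_pos ht.le hu.le hv.le
  have hW : 0 < denomW s t v := by
    unfold denomW
    positivity
  rw [rhoFactor, mul_div_assoc, ← Real.sqrt_div (by positivity),
    ← Real.sqrt_sq (show 0 ≤ s * t * u * v ^ 2 by positivity), ← Real.sqrt_mul (by positivity),
    racahRho]
  congr 1
  have e1 : 1 / t * (1 / s) + (1 / t * (1 / u) * (1 / v) + 1) * (1 / s) =
      denomM t u v / (s * t * u * v) := by
    rw [denomM]
    field_simp
    ring
  have e2 : 1 / t * (1 / v) + 1 / s + 1 / t * (1 / s) = denomW s t v / (s * t * v) := by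
    rw [denomW]
    field_simp
    ring
  have e3 : (1 / t * (1 / u) * (1 / v) + 1) * (1 / s) - 1 / s = 1 / (s * t * u * v) := by
    field_simp
    ring
  have e4 : 1 / s + 1 / t * (1 / s) = (1 + t) / (s * t) := by
    field_simp
    ring
  rw [e1, e2, e3, e4]
  field_simp

theorem racahSigma_eq_racahA {α b d ν : ℝ} (h : 0 < α + b * α) :
    racahSigma α b d ν = racahA α (b * α) (b * ν) ((b * d * ν + 1) * α) 0 := by
  have h1 : α + b * α + 1 ≠ 0 := by linarith
  have h2 : α + b * α + 2 ≠ 0 := by linarith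
  simp only [racahSigma, racahA, mul_zero, zero_add, zero_sub]
  generalize α + b * α + 2 = d2 at h2
  generalize α + b * α + 1 = d1 at h1
  field_simp

theorem rho_mul_shift_eq_limitB {m s t u v : ℝ} (hm : 0 ≤ m) (hs : 0 < s) (ht : 0 < t)
    (hu : 0 < u) (hv : 0 < v) :
    s * t * u * v ^ 2 * rhoFactor t u v / √(denomW s t v) *
      (scaledA m s t u v / (s * t * u * v ^ 2) + scaledC m s t u v / (s * t * u * v ^ 2) -
        scaledA 0 s t u v / (s * t * u * v ^ 2)) = limitB m s t u v := by
  have key := scaledA_add_scaledC_sub (u := u) (v := v)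
    (denomD_pos (k := 1) (by positivity) hs.le ht.le).ne'
    (denomD_pos (k := 2) (by positivity) hs.le ht.le).ne'
    (denomD_pos (k := 2 * m) (by positivity) hs.le ht.le).ne'
    (denomD_pos (k := 2 * m + 1) (by positivity) hs.le ht.le).ne'
    (denomD_pos (k := 2 * m + 2) (by positivity) hs.le ht.le).ne'
  have hJ : s * t * u * v ^ 2 ≠ 0 := by positivity
  rw [← add_div, ← sub_div, key, limitB]
  generalize s * t * u * v ^ 2 = J at hJ
  rw [div_mul_div_comm, mul_comm J, mul_assoc, mul_comm (√_), mul_left_comm, mul_div_mul_left _ _ hJ]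
  ring

theorem rho_sq_mul_eq_limitG {m s t u v : ℝ} (hs : 0 < s) (ht : 0 < t)
    (hu : 0 < u) (hv : 0 < v) :
    (s * t * u * v ^ 2 * rhoFactor t u v / √(denomW s t v)) ^ 2 *
      (scaledA m s t u v / (s * t * u * v ^ 2) * (scaledC (m + 1) s t u v / (s * t * u * v ^ 2))) =
    limitG m s t u v := by
  have hM := denomM_pos ht.le hu.le hv.le
  have hW : 0 < denomW s t v := by
    unfold denomW
    positivity
  have hJ : s * t * u * v ^ 2 ≠ 0 := by positivity
  have hK : rhoFactor t u v ^ 2 = (1 + t) ^ 3 * (denomM t u v)⁻¹ := by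
    rw [rhoFactor, Real.sq_sqrt (by positivity), div_eq_mul_inv]
  have hr : √(denomW s t v) ^ 2 = denomW s t v := Real.sq_sqrt hW.le
  have hC : scaledC (m + 1) s t u v =
      denomW s t v * ((m + 1) * (1 + (m + 2) * t * (s / √(denomW s t v)) * (v / √(denomW s t v))) *
      ((m + 1) * (s * t * u * v) - 1) * ((m + 1) * (s * t) + 1) *
      (denomD (2 * m + 2) s t)⁻¹ * (denomD (2 * m + 3) s t)⁻¹) := by
    have e : denomW s t v * (1 + (m + 2) * t * (s / √(denomW s t v)) * (v / √(denomW s t v))) =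
        (m + 1 + 1) * (s * t * v) + denomW s t v := by
      have : s / √(denomW s t v) * (v / √(denomW s t v)) = s * v / denomW s t v := by
        rw [div_mul_div_comm, ← sq, hr]
      rw [mul_assoc _ (s / _), this]
      field_simp
      ring
    rw [scaledC, ← e, show 2 * (m + 1) + 1 = 2 * m + 3 by ring,
      show 2 * (m + 1) = 2 * m + 2 by ring]
    ring
  rw [limitG, hC, ← hK, div_pow, hr]
  generalize (m + 1) * (1 + (m + 2) * t * (s / √(denomW s t v)) * (v / √(denomW s t v))) *
      ((m + 1) * (s * t * u * v) - 1) * ((m + 1) * (s * t) + 1) *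
      (denomD (2 * m + 2) s t)⁻¹ * (denomD (2 * m + 3) s t)⁻¹ = X
  generalize s * t * u * v ^ 2 = J at hJ
  field_simp

/-- The continuous extension of the rescaled Racah polynomials, by the limiting recurrence. -/
noncomputable def racahExtension (x : ℝ) : ℕ → ℝ × ℝ × ℝ × ℝ → ℝ
  | 0, _ => 1
  | 1, _ => x
  | n + 2, p =>
    (x + limitB (n + 1) p.1 p.2.1 p.2.2.1 p.2.2.2) * racahExtension x (n + 1) p -
      limitG n p.1 p.2.1 p.2.2.1 p.2.2.2 * racahExtension x n p

theorem continuousOn_racahExtension (x : ℝ) (n : ℕ) :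
    ContinuousOn (racahExtension x n) orthant := by
  induction n using Nat.twoStepInduction with
  | zero => exact continuousOn_const
  | one => exact continuousOn_const
  | more n ih0 ih1 =>
    exact ((continuousOn_const.add (continuousOn_limitB (by positivity))).mul ih1).sub
      ((continuousOn_limitG n.cast_nonneg).mul ih0)

theorem racahExtension_eq_rescaledRacah (x : ℝ) {s t u v : ℝ} (hs : 0 < s) (ht : 0 < t)
    (hu : 0 < u) (hv : 0 < v) (n : ℕ) :
    racahExtension x n (s, t, u, v) = rescaledRacah (1 / s) (1 / t) (1 / u) (1 / v) n x := by
  have hab : 0 < 1 / s + 1 / t * (1 / s) := by positivity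
  have hρ := racahRho_inverse_parameters hs ht hu hv
  have hρ0 : racahRho (1 / s) (1 / t) (1 / u) (1 / v) ≠ 0 := by
    have hM := denomM_pos ht.le hu.le hv.le
    have hW : 0 < denomW s t v := by
      unfold denomW
      positivity
    rw [hρ, rhoFactor]
    positivity
  induction n using Nat.twoStepInduction with
  | zero => simp [racahExtension, rescaledRacah, monicRacah_zero]
  | one =>
    rw [rescaledRacah, monicRacah_one hab, racahSigma_eq_racahA hab, sub_add_cancel, pow_one,
      mul_div_cancel₀ x hρ0, racahExtension]
  | more n ih0 ih1 =>
    have hn : (0 : ℝ) ≤ n := n.cast_nonneg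
    have hn1 : (0 : ℝ) ≤ (n : ℝ) + 1 := by positivity
    rw [rescaledRacah, monicRacah_rescaled_recurrence hab _ _ hρ0, ← rescaledRacah,
      ← rescaledRacah, ← ih0, ← ih1, racahSigma_eq_racahA hab, hρ,
      racahA_inverse_parameters hn hs ht hu hv, racahA_inverse_parameters hn1 hs ht hu hv,
      racahA_inverse_parameters le_rfl hs ht hu hv, racahC_inverse_parameters hn1 hs ht hu hv,
      rho_mul_shift_eq_limitB hn1 hs ht hu hv, rho_sq_mul_eq_limitG hs ht hu hv, racahExtension]

/-- `(s,t,u,v) ↦ p_n(x; 1/s, 1/t, 1/u, 1/v)` extends continuously to the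
closed orthant `[0,∞)⁴`. -/
theorem rescaled_racah_continuous_extension (n : ℕ) (x : ℝ) :
    ∃ q : ℝ × ℝ × ℝ × ℝ → ℝ,
      ContinuousOn q (Set.Ici 0 ×ˢ (Set.Ici 0 ×ˢ (Set.Ici 0 ×ˢ Set.Ici 0))) ∧
      ∀ s t u v : ℝ, 0 < s → 0 < t → 0 < u → 0 < v →
        q (s, t, u, v) = rescaledRacah (1 / s) (1 / t) (1 / u) (1 / v) n x := by
  exact ⟨racahExtension x n, continuousOn_racahExtension x n,
    fun s t u v hs ht hu hv => racahExtension_eq_rescaledRacah x hs ht hu hv n⟩
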